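/- Let f : ℝ^d → ℝ be C¹ with globally (β,ν)-Hölder gradient, β > 0, ν ∈ (0,1], and let δ ∈ (0,1). If x ∈ ℝ^d and λ > 0 satisfy λ^ν ≤ ((1−δ)(ν+1)/β) · min{1, ‖∇f(x)‖^{1−ν}}, then f(x − λ∇f(x)) ≤ f(x) − δ λ ‖∇f(x)‖². -/

import Mathlib

/-- **Descent lemma.** A differentiable function whose gradient is globally `(β,ν)`-Hölder
lies below its first-order expansion plus `β / (ν + 1) * ‖v‖ ^ (ν + 1)`. -/
theorem le_add_inner_gradient_add_rpow_of_holder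
    {E : Type*} [NormedAddCommGroup E] [InnerProductSpace ℝ E] [CompleteSpace E]
    {f : E → ℝ} (hf : Differentiable ℝ f) {β ν : ℝ} (hν : 0 < ν)
    (hH : ∀ x y : E, ‖gradient f x - gradient f y‖ ≤ β * ‖x - y‖ ^ ν) (x v : E) :
    f (x + v) ≤ f x + inner ℝ (gradient f x) v + β / (ν + 1) * ‖v‖ ^ (ν + 1) := by
  have hφ (t : ℝ) : HasDerivAt (fun t : ℝ => f (x + t • v))
      (inner ℝ (gradient f (x + t • v)) v) t := by
    have hline : HasDerivAt (fun t : ℝ => x + t • v) v t := by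
      simpa using ((hasDerivAt_id t).smul_const v).const_add x
    simpa [Function.comp_def] using
      (hf (x + t • v)).hasGradientAt.hasFDerivAt.comp_hasDerivAt t hline
  have hB (t : ℝ) : HasDerivAt
      (fun t : ℝ => f x + t * inner ℝ (gradient f x) v
        + β / (ν + 1) * ‖v‖ ^ (ν + 1) * t ^ (ν + 1))
      (inner ℝ (gradient f x) v + β * ‖v‖ ^ (ν + 1) * t ^ ν) t := by
    have hpow : HasDerivAt (fun t : ℝ => t ^ (ν + 1)) ((ν + 1) * t ^ ν) t := by
      simpa using Real.hasDerivAt_rpow_const (x := t) (p := ν + 1) (Or.inr (by linarith))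
    refine ((((hasDerivAt_id t).mul_const (inner ℝ (gradient f x) v)).const_add (f x)).add
      (hpow.const_mul (β / (ν + 1) * ‖v‖ ^ (ν + 1)))).congr_deriv ?_
    field_simp
  have key := image_le_of_deriv_right_le_deriv_boundary (a := 0) (b := 1)
    (fun t _ => (hφ t).continuousAt.continuousWithinAt)
    (fun t _ => (hφ t).hasDerivWithinAt)
    (by simp [Real.zero_rpow (by linarith : ν + 1 ≠ 0)])
    (fun t _ => (hB t).continuousAt.continuousWithinAt)
    (fun t _ => (hB t).hasDerivWithinAt)
    (fun t ht => by
      have hnorm : ‖gradient f (x + t • v) - gradient f x‖ ≤ β * (t ^ ν * ‖v‖ ^ ν) := by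
        have h := hH (x + t • v) x
        rwa [add_sub_cancel_left, norm_smul, Real.norm_of_nonneg ht.1,
          Real.mul_rpow ht.1 (norm_nonneg v)] at h
      have hinner := real_inner_le_norm (gradient f (x + t • v) - gradient f x) v
      rw [inner_sub_left] at hinner
      have hmul := mul_le_mul_of_nonneg_right hnorm (norm_nonneg v)
      rw [Real.rpow_add_one' (norm_nonneg v) (by linarith)]
      linarith)
    (Set.right_mem_Icc.2 zero_le_one)
  simpa using key

/-- **Sufficient-decrease condition for small enough steps.** If `∇f` is globally
`(β,ν)`-Hölder and `λ^ν ≤ ((1-δ)(ν+1)/β) min{1, ‖∇f(x)‖^(1-ν)}`, then the gradient step of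
size `λ` decreases `f` by at least `δ λ ‖∇f(x)‖²`. -/
theorem small_step_sufficient_decrease {d : ℕ}
    (f : EuclideanSpace ℝ (Fin d) → ℝ) (hf : ContDiff ℝ 1 f)
    (β ν : ℝ) (hβ : 0 < β) (hν : ν ∈ Set.Ioc (0 : ℝ) 1)
    (hH : ∀ x y : EuclideanSpace ℝ (Fin d),
      ‖gradient f x - gradient f y‖ ≤ β * ‖x - y‖ ^ ν)
    (δ : ℝ) (hδ : δ ∈ Set.Ioo (0 : ℝ) 1)
    (x : EuclideanSpace ℝ (Fin d)) (lam : ℝ) (hlam : 0 < lam)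
    (hsmall : lam ^ ν ≤ ((1 - δ) * (ν + 1) / β) * min 1 (‖gradient f x‖ ^ (1 - ν))) :
    f (x - lam • gradient f x) ≤ f x - δ * lam * ‖gradient f x‖ ^ 2 := by
  obtain ⟨hν0, -⟩ := hν
  rcases eq_or_ne (gradient f x) 0 with hg | hg
  · simp [hg]
  have hg0 : 0 < ‖gradient f x‖ := norm_pos_iff.2 hg
  have hdescent := le_add_inner_gradient_add_rpow_of_holder
    (hf.differentiable (by simp)) hν0 hH x (-(lam • gradient f x))
  rw [← sub_eq_add_neg, inner_neg_right, real_inner_smul_right, real_inner_self_eq_norm_sq,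
    norm_neg, norm_smul, Real.norm_of_nonneg hlam.le, Real.mul_rpow hlam.le hg0.le] at hdescent
  have hstep : β / (ν + 1) * lam ^ ν ≤ (1 - δ) * ‖gradient f x‖ ^ (1 - ν) := by
    have hδ1 : 0 < 1 - δ := sub_pos.2 hδ.2
    have h : lam ^ ν ≤ (1 - δ) * (ν + 1) / β * ‖gradient f x‖ ^ (1 - ν) :=
      hsmall.trans (mul_le_mul_of_nonneg_left (min_le_right _ _) (by positivity))
    calc β / (ν + 1) * lam ^ ν
        ≤ β / (ν + 1) * ((1 - δ) * (ν + 1) / β * ‖gradient f x‖ ^ (1 - ν)) := by gcongr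
      _ = (1 - δ) * ‖gradient f x‖ ^ (1 - ν) := by field_simp
  have hsq : ‖gradient f x‖ ^ (1 - ν) * ‖gradient f x‖ ^ (ν + 1) = ‖gradient f x‖ ^ 2 := by
    rw [← Real.rpow_add hg0, ← Real.rpow_two]
    ring_nf
  have hremainder : β / (ν + 1) * (lam ^ (ν + 1) * ‖gradient f x‖ ^ (ν + 1))
      ≤ (1 - δ) * lam * ‖gradient f x‖ ^ 2 := by
    calc β / (ν + 1) * (lam ^ (ν + 1) * ‖gradient f x‖ ^ (ν + 1))
        = β / (ν + 1) * lam ^ ν * (lam * ‖gradient f x‖ ^ (ν + 1)) := by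
          rw [Real.rpow_add_one hlam.ne']
          ring
      _ ≤ (1 - δ) * ‖gradient f x‖ ^ (1 - ν) * (lam * ‖gradient f x‖ ^ (ν + 1)) := by
          gcongr
      _ = (1 - δ) * lam * ‖gradient f x‖ ^ 2 := by
          rw [← hsq]
          ring
  linarith
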